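/- Fix q ∈ ℝ with 0 < q < 1/2 and let a(Δ) := (Q(q)^Δ)_{1,0}. Then the Whittle index sequence W(H) := (H(a(H−1)−a(H)) + a(H)) / ((H−1)(a(H−1)−a(H)) + a(H) + q) is strictly increasing over integers H ≥ 1. (This monotonicity is the key property establishing indexability of the decoupled single-channel spectrum-sharing problem.) -/

import Mathlib

open Matrix

/-- The one-step transition matrix of a symmetric two-state Markov chain
with switching probability `q`. -/
def Qmat (q : ℝ) : Matrix (Fin 2) (Fin 2) ℝ := !![1 - q, q; q, 1 - q]

/-- `a q Δ` is the `(1,0)` entry of the `Δ`-th power of `Qmat q`. -/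
def a (q : ℝ) (Δ : ℕ) : ℝ := (Qmat q ^ Δ) 1 0

/-- The Whittle index in state `(X̂ = 1, AoI = H)`. -/
noncomputable def W (q : ℝ) (H : ℕ) : ℝ :=
  ((H : ℝ) * (a q (H - 1) - a q H) + a q H) /
    (((H : ℝ) - 1) * (a q (H - 1) - a q H) + a q H + q)

theorem Qmat_pow (q : ℝ) (n : ℕ) :
    Qmat q ^ n = !![(1 + (1 - 2 * q) ^ n) / 2, (1 - (1 - 2 * q) ^ n) / 2;
      (1 - (1 - 2 * q) ^ n) / 2, (1 + (1 - 2 * q) ^ n) / 2] := by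
  induction n with
  | zero => ext i j; fin_cases i <;> fin_cases j <;> simp
  | succ n ih =>
    rw [pow_succ, ih, Qmat]
    ext i j
    fin_cases i <;> fin_cases j <;> simp [Matrix.mul_apply, Fin.sum_univ_two] <;> ring

theorem a_eq (q : ℝ) (n : ℕ) : a q n = (1 - (1 - 2 * q) ^ n) / 2 := by
  simp [a, Qmat_pow]

/-- The denominator of `W q (n + 1)`, in closed form. -/
noncomputable def whittleDenom (q : ℝ) (n : ℕ) : ℝ :=
  (1 + 2 * q - (1 - 2 * q) ^ (n + 1)) / 2 - n * q * (1 - 2 * q) ^ n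

theorem whittleDenom_succ (q : ℝ) (n : ℕ) :
    whittleDenom q (n + 1) = whittleDenom q n + 2 * n * q ^ 2 * (1 - 2 * q) ^ n := by
  simp only [whittleDenom]
  push_cast
  ring

theorem whittleDenom_pos {q : ℝ} (hq0 : 0 < q) (hq1 : q < 1 / 2) (n : ℕ) :
    0 < whittleDenom q n := by
  induction n with
  | zero => simp only [whittleDenom]; norm_num; linarith
  | succ n ih =>
    have hr : 0 < 1 - 2 * q := by linarith
    rw [whittleDenom_succ]
    positivity

theorem W_succ {q : ℝ} (hq0 : 0 < q) (hq1 : q < 1 / 2) (n : ℕ) :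
    W q (n + 1) = 1 - q * (1 + (1 - 2 * q) ^ n) / whittleDenom q n := by
  have hD := (whittleDenom_pos hq0 hq1 n).ne'
  have hden : ((n + 1 : ℕ) - 1 : ℝ) * (a q (n + 1 - 1) - a q (n + 1)) + a q (n + 1) + q =
      whittleDenom q n := by
    simp only [a_eq, whittleDenom, Nat.add_sub_cancel]
    push_cast
    ring
  rw [W, hden, eq_sub_iff_add_eq, ← add_div, div_eq_one_iff_eq hD, ← hden]
  simp only [a_eq, Nat.add_sub_cancel]
  ring

theorem W_succ_lt {q : ℝ} (hq0 : 0 < q) (hq1 : q < 1 / 2) (n : ℕ) :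
    W q (n + 1) < W q (n + 1 + 1) := by
  have hr : 0 < 1 - 2 * q := by linarith
  have hx : 0 < (1 - 2 * q) ^ n := pow_pos hr n
  rw [W_succ hq0 hq1, W_succ hq0 hq1]
  refine sub_lt_sub_left (div_lt_div₀ ?_ ?_ (by positivity) (whittleDenom_pos hq0 hq1 n)) 1
  · have : (1 - 2 * q) ^ (n + 1) < (1 - 2 * q) ^ n := by
      rw [pow_succ]
      exact mul_lt_of_lt_one_right hx (by linarith)
    gcongr
  · rw [whittleDenom_succ]
    exact le_add_of_nonneg_right (by positivity)

theorem stmt_11 (q : ℝ) (hq0 : 0 < q) (hq1 : q < 1/2) :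
    ∀ H₁ H₂ : ℕ, 1 ≤ H₁ → H₁ < H₂ → W q H₁ < W q H₂ := by
  intro H₁ H₂ h₁ h
  obtain ⟨m, rfl⟩ := Nat.exists_eq_add_of_le' h₁
  obtain ⟨n, rfl⟩ := Nat.exists_eq_add_of_le' (h₁.trans h.le)
  exact strictMono_nat_of_lt_succ (W_succ_lt hq0 hq1) (Nat.lt_of_add_lt_add_right h)
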